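/- arXiv:1207.5964 — 5 statements merged into one kernel-verified Lean document; each statement's English description precedes it below -/
import Mathlib

section
/- Fix x₁ ∈ (0,1) and set V(s) = (1/2)·s·log s + f(s,0) for s ∈ (0,1), so that V''(s) = 1/(2s) + ∂₁²f(s,0). Assume V''(s) > 0 for all s ∈ (0,1). Then lim_{x₂→0⁺} ∂₁∂₁(u¹¹)(x₁,x₂) = (1/V'')''(x₁). -/
open Real Filter Set Topology

/-- First partial derivative of a function of two real variables. -/
noncomputable def pd1 (g : ℝ → ℝ → ℝ) : ℝ → ℝ → ℝ := fun x y => deriv (fun s => g s y) x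

/-- Second partial derivative of a function of two real variables. -/
noncomputable def pd2 (g : ℝ → ℝ → ℝ) : ℝ → ℝ → ℝ := fun x y => deriv (fun s => g x s) y

/-- The symplectic potential in Guillemin normal form near a corner:
`u(x₁,x₂) = (1/2)(x₁ log x₁ + x₂ log x₂) + f(x₁,x₂)`. -/
noncomputable def upot (f : ℝ → ℝ → ℝ) : ℝ → ℝ → ℝ :=
  fun x y => 1 / 2 * (x * Real.log x + y * Real.log y) + f x y

/-- Determinant `D = u₁₁ u₂₂ − u₁₂²` of the Hessian of `u`. -/
noncomputable def hessDet (f : ℝ → ℝ → ℝ) : ℝ → ℝ → ℝ :=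
  fun x y => pd1 (pd1 (upot f)) x y * pd2 (pd2 (upot f)) x y - (pd1 (pd2 (upot f)) x y) ^ 2

/-- Entry `u¹¹ = u₂₂ / D` of the inverse Hessian of `u`. -/
noncomputable def uInv11 (f : ℝ → ℝ → ℝ) : ℝ → ℝ → ℝ :=
  fun x y => pd2 (pd2 (upot f)) x y / hessDet f x y

/-- Entry `u¹² = u²¹ = −u₁₂ / D` of the inverse Hessian of `u`. -/
noncomputable def uInv12 (f : ℝ → ℝ → ℝ) : ℝ → ℝ → ℝ :=
  fun x y => -(pd1 (pd2 (upot f)) x y) / hessDet f x y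

/-- Entry `u²² = u₁₁ / D` of the inverse Hessian of `u`. -/
noncomputable def uInv22 (f : ℝ → ℝ → ℝ) : ℝ → ℝ → ℝ :=
  fun x y => pd1 (pd1 (upot f)) x y / hessDet f x y

theorem hasDerivAt_half_mul_log {x : ℝ} (hx : x ≠ 0) (c : ℝ) :
    HasDerivAt (fun s => 1 / 2 * (s * Real.log s + c)) (1 / 2 * (Real.log x + 1)) x :=
  ((Real.hasDerivAt_mul_log hx).add_const c).const_mul _

theorem hasDerivAt_half_log_add_one {x : ℝ} (hx : x ≠ 0) :
    HasDerivAt (fun s => 1 / 2 * (Real.log s + 1)) (1 / (2 * x)) x := by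
  have h : 1 / (2 * x) = 1 / 2 * x⁻¹ := by rw [one_div, one_div, mul_inv]
  exact h ▸ ((Real.hasDerivAt_log hx).add_const 1).const_mul (1 / 2)

theorem hasDerivAt_pd1 {g : ℝ → ℝ → ℝ} {x y : ℝ}
    (h : DifferentiableAt ℝ (Function.uncurry g) (x, y)) :
    HasDerivAt (fun s => g s y) (fderiv ℝ (Function.uncurry g) (x, y) (1, 0)) x :=
  HasFDerivAt.comp_hasDerivAt (l := Function.uncurry g) (f := fun s => (s, y)) x h.hasFDerivAt
    ((hasDerivAt_id x).prodMk (hasDerivAt_const x y))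

theorem hasDerivAt_pd2 {g : ℝ → ℝ → ℝ} {x y : ℝ}
    (h : DifferentiableAt ℝ (Function.uncurry g) (x, y)) :
    HasDerivAt (fun s => g x s) (fderiv ℝ (Function.uncurry g) (x, y) (0, 1)) y :=
  HasFDerivAt.comp_hasDerivAt (l := Function.uncurry g) (f := fun s => (x, s)) y h.hasFDerivAt
    ((hasDerivAt_const y x).prodMk (hasDerivAt_id y))

theorem ContDiffAt.uncurry_pd1 {g : ℝ → ℝ → ℝ} {p : ℝ × ℝ}
    (h : ContDiffAt ℝ (⊤ : ℕ∞) (Function.uncurry g) p) :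
    ContDiffAt ℝ (⊤ : ℕ∞) (Function.uncurry (pd1 g)) p := by
  have h1 : ContDiffAt ℝ 1 (Function.uncurry g) p := h.of_le (by exact_mod_cast le_top)
  refine ((h.fderiv_right (m := (⊤ : ℕ∞)) (by rfl)).clm_apply
    (contDiffAt_const (c := ((1 : ℝ), (0 : ℝ))))).congr_of_eventuallyEq ?_
  filter_upwards [h1.eventually (by simp)] with q hq
  exact (hasDerivAt_pd1 (hq.differentiableAt (by simp))).deriv

theorem ContDiffAt.uncurry_pd2 {g : ℝ → ℝ → ℝ} {p : ℝ × ℝ}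
    (h : ContDiffAt ℝ (⊤ : ℕ∞) (Function.uncurry g) p) :
    ContDiffAt ℝ (⊤ : ℕ∞) (Function.uncurry (pd2 g)) p := by
  have h1 : ContDiffAt ℝ 1 (Function.uncurry g) p := h.of_le (by exact_mod_cast le_top)
  refine ((h.fderiv_right (m := (⊤ : ℕ∞)) (by rfl)).clm_apply
    (contDiffAt_const (c := ((0 : ℝ), (1 : ℝ))))).congr_of_eventuallyEq ?_
  filter_upwards [h1.eventually (by simp)] with q hq
  exact (hasDerivAt_pd2 (hq.differentiableAt (by simp))).deriv

theorem ContDiff.uncurry_pd1 {g : ℝ → ℝ → ℝ}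
    (h : ContDiff ℝ (⊤ : ℕ∞) (Function.uncurry g)) :
    ContDiff ℝ (⊤ : ℕ∞) (Function.uncurry (pd1 g)) :=
  contDiff_iff_contDiffAt.2 fun _ => h.contDiffAt.uncurry_pd1

theorem ContDiff.uncurry_pd2 {g : ℝ → ℝ → ℝ}
    (h : ContDiff ℝ (⊤ : ℕ∞) (Function.uncurry g)) :
    ContDiff ℝ (⊤ : ℕ∞) (Function.uncurry (pd2 g)) :=
  contDiff_iff_contDiffAt.2 fun _ => h.contDiffAt.uncurry_pd2

theorem ContDiff.differentiableAt_left {g : ℝ → ℝ → ℝ}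
    (h : ContDiff ℝ (⊤ : ℕ∞) (Function.uncurry g)) (x y : ℝ) :
    DifferentiableAt ℝ (fun s => g s y) x :=
  (hasDerivAt_pd1 (h.differentiable (by simp) _)).differentiableAt

theorem ContDiff.differentiableAt_right {g : ℝ → ℝ → ℝ}
    (h : ContDiff ℝ (⊤ : ℕ∞) (Function.uncurry g)) (x y : ℝ) :
    DifferentiableAt ℝ (fun s => g x s) y :=
  (hasDerivAt_pd2 (h.differentiable (by simp) _)).differentiableAt

theorem deriv_deriv_eqOn_Ioo {g h : ℝ → ℝ} {a b : ℝ} (H : EqOn g h (Ioo a b)) :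
    EqOn (deriv (deriv g)) (deriv (deriv h)) (Ioo a b) :=
  (H.deriv isOpen_Ioo).deriv isOpen_Ioo

theorem pd1_upot {f : ℝ → ℝ → ℝ} (hf : ContDiff ℝ (⊤ : ℕ∞) (Function.uncurry f))
    {x : ℝ} (hx : x ≠ 0) (y : ℝ) :
    pd1 (upot f) x y = 1 / 2 * (Real.log x + 1) + pd1 f x y :=
  ((hasDerivAt_half_mul_log hx _).add (hf.differentiableAt_left x y).hasDerivAt).deriv

theorem pd2_upot {f : ℝ → ℝ → ℝ} (hf : ContDiff ℝ (⊤ : ℕ∞) (Function.uncurry f))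
    (x : ℝ) {y : ℝ} (hy : y ≠ 0) :
    pd2 (upot f) x y = 1 / 2 * (Real.log y + 1) + pd2 f x y := by
  have h := (hasDerivAt_half_mul_log hy (x * Real.log x)).add
    (hf.differentiableAt_right x y).hasDerivAt
  refine (h.congr_of_eventuallyEq (.of_forall fun s => ?_)).deriv
  simp only [upot, Pi.add_apply, add_comm]

theorem pd1_pd1_upot {f : ℝ → ℝ → ℝ} (hf : ContDiff ℝ (⊤ : ℕ∞) (Function.uncurry f))
    {x : ℝ} (hx : x ≠ 0) (y : ℝ) :
    pd1 (pd1 (upot f)) x y = 1 / (2 * x) + pd1 (pd1 f) x y := by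
  refine (((hasDerivAt_half_log_add_one hx).add
    (hf.uncurry_pd1.differentiableAt_left x y).hasDerivAt).congr_of_eventuallyEq ?_).deriv
  filter_upwards [eventually_ne_nhds hx] with s hs
  exact pd1_upot hf hs y

theorem pd2_pd2_upot {f : ℝ → ℝ → ℝ} (hf : ContDiff ℝ (⊤ : ℕ∞) (Function.uncurry f))
    (x : ℝ) {y : ℝ} (hy : y ≠ 0) :
    pd2 (pd2 (upot f)) x y = 1 / (2 * y) + pd2 (pd2 f) x y := by
  refine (((hasDerivAt_half_log_add_one hy).add
    (hf.uncurry_pd2.differentiableAt_right x y).hasDerivAt).congr_of_eventuallyEq ?_).deriv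
  filter_upwards [eventually_ne_nhds hy] with s hs
  exact pd2_upot hf x hs

theorem pd1_pd2_upot {f : ℝ → ℝ → ℝ} (hf : ContDiff ℝ (⊤ : ℕ∞) (Function.uncurry f))
    (x : ℝ) {y : ℝ} (hy : y ≠ 0) :
    pd1 (pd2 (upot f)) x y = pd1 (pd2 f) x y := by
  refine (((hasDerivAt_const x _).add
    (hf.uncurry_pd2.differentiableAt_left x y).hasDerivAt).congr_of_eventuallyEq
      (.of_forall fun s => pd2_upot hf s hy)).deriv.trans (zero_add _)

/-- Numerator and denominator of `u¹¹` multiplied by `2 x₂`; this expression extends smoothly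
across `x₂ = 0`. -/
noncomputable def uInv11Ext (f : ℝ → ℝ → ℝ) : ℝ → ℝ → ℝ := fun x y =>
  (1 + 2 * y * pd2 (pd2 f) x y) /
    ((1 / (2 * x) + pd1 (pd1 f) x y) * (1 + 2 * y * pd2 (pd2 f) x y) -
      2 * y * pd1 (pd2 f) x y ^ 2)

theorem uInv11_eq_uInv11Ext {f : ℝ → ℝ → ℝ} (hf : ContDiff ℝ (⊤ : ℕ∞) (Function.uncurry f))
    {x y : ℝ} (hx : x ≠ 0) (hy : y ≠ 0) : uInv11 f x y = uInv11Ext f x y := by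
  have h2y : 2 * y ≠ 0 := mul_ne_zero two_ne_zero hy
  rw [uInv11, hessDet, pd1_pd1_upot hf hx, pd2_pd2_upot hf x hy, pd1_pd2_upot hf x hy,
    uInv11Ext, ← mul_div_mul_left _ _ h2y]
  congr 1 <;> field_simp

theorem uInv11Ext_zero (f : ℝ → ℝ → ℝ) (x : ℝ) :
    uInv11Ext f x 0 = (1 / (2 * x) + pd1 (pd1 f) x 0)⁻¹ := by
  simp [uInv11Ext]

theorem contDiffAt_uInv11Ext {f : ℝ → ℝ → ℝ} (hf : ContDiff ℝ (⊤ : ℕ∞) (Function.uncurry f))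
    {x : ℝ} (hx : x ≠ 0) (h : 1 / (2 * x) + pd1 (pd1 f) x 0 ≠ 0) :
    ContDiffAt ℝ (⊤ : ℕ∞) (Function.uncurry (uInv11Ext f)) (x, 0) := by
  have h11 := hf.uncurry_pd1.uncurry_pd1.contDiffAt (x := (x, (0 : ℝ)))
  have h12 := hf.uncurry_pd2.uncurry_pd1.contDiffAt (x := (x, (0 : ℝ)))
  have h22 := hf.uncurry_pd2.uncurry_pd2.contDiffAt (x := (x, (0 : ℝ)))
  have hy : ContDiffAt ℝ (⊤ : ℕ∞) (fun p : ℝ × ℝ => 2 * p.2) (x, 0) :=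
    contDiffAt_const.mul contDiffAt_snd
  have hinv : ContDiffAt ℝ (⊤ : ℕ∞) (fun p : ℝ × ℝ => 1 / (2 * p.1)) (x, 0) :=
    contDiffAt_const.div (contDiffAt_const.mul contDiffAt_fst) (by simpa using hx)
  have hnum := (contDiffAt_const (c := (1 : ℝ))).add (hy.mul h22)
  exact hnum.div (((hinv.add h11).mul hnum).sub (hy.mul (h12.pow 2)))
    (by simpa [Function.uncurry] using h)

theorem deriv_deriv_of_eq_mul_log {f : ℝ → ℝ → ℝ}
    (hf : ContDiff ℝ (⊤ : ℕ∞) (Function.uncurry f)) {V : ℝ → ℝ}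
    (hV : ∀ s ∈ Ioo (0:ℝ) 1, V s = 1 / 2 * s * Real.log s + f s 0) {s : ℝ}
    (hs : s ∈ Ioo (0:ℝ) 1) : deriv (deriv V) s = 1 / (2 * s) + pd1 (pd1 f) s 0 := by
  have H : EqOn V (fun s => upot f s 0) (Ioo 0 1) := fun s hs => by
    simp [hV s hs, upot, mul_assoc]
  exact (deriv_deriv_eqOn_Ioo H hs).trans (pd1_pd1_upot hf hs.1.ne' 0)

/-- Fix `x₁ ∈ (0,1)` and set `V(s) = (1/2) s log s + f(s,0)`, so that
`V''(s) = 1/(2s) + ∂₁²f(s,0)`; assume `V'' > 0` on `(0,1)`.  Then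
`lim_{x₂→0⁺} ∂₁∂₁(u¹¹)(x₁,x₂) = (1/V'')''(x₁)`. -/
theorem stmt0 (f : ℝ → ℝ → ℝ) (hf : ContDiff ℝ (⊤ : ℕ∞) (Function.uncurry f))
    (hpos : ∀ x ∈ Ioo (0:ℝ) 1, ∀ y ∈ Ioo (0:ℝ) 1,
      0 < hessDet f x y ∧ 0 < pd1 (pd1 (upot f)) x y)
    (x₁ : ℝ) (hx₁ : x₁ ∈ Ioo (0:ℝ) 1)
    (V : ℝ → ℝ) (hV : ∀ s ∈ Ioo (0:ℝ) 1, V s = 1 / 2 * s * Real.log s + f s 0)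
    (hV'' : ∀ s ∈ Ioo (0:ℝ) 1, 0 < deriv (deriv V) s) :
    Tendsto (fun x₂ => pd1 (pd1 (uInv11 f)) x₁ x₂) (𝓝[>] 0)
      (𝓝 (deriv (deriv fun s => (deriv (deriv V) s)⁻¹) x₁)) := by
  have hne := (hV'' x₁ hx₁).ne'
  rw [deriv_deriv_of_eq_mul_log hf hV hx₁] at hne
  have hlim : Tendsto (fun y => pd1 (pd1 (uInv11Ext f)) x₁ y) (𝓝[>] 0)
      (𝓝 (pd1 (pd1 (uInv11Ext f)) x₁ 0)) :=
    ((contDiffAt_uInv11Ext hf hx₁.1.ne' hne).uncurry_pd1.uncurry_pd1.continuousAt.tendsto.comp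
      (Continuous.prodMk_right x₁).continuousAt).mono_left nhdsWithin_le_nhds
  have hval : deriv (deriv fun s => (deriv (deriv V) s)⁻¹) x₁ =
      pd1 (pd1 (uInv11Ext f)) x₁ 0 :=
    deriv_deriv_eqOn_Ioo (fun s hs => by
      rw [uInv11Ext_zero, deriv_deriv_of_eq_mul_log hf hV hs]) hx₁
  rw [hval]
  refine hlim.congr' ?_
  filter_upwards [self_mem_nhdsWithin] with y hy
  exact deriv_deriv_eqOn_Ioo
    (fun s hs => (uInv11_eq_uInv11Ext hf hs.1.ne' (ne_of_gt hy)).symm) hx₁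
end

section
/- The function h(s) = 1/V''(s) on (0,1] satisfies lim_{s→0⁺} h(s) = 0 and lim_{s→0⁺} h'(s) = 2. -/
open Real Filter Set Topology

/-- In the interior of a set, the second derivative within the set is the second derivative. -/
lemma derivWithin_derivWithin_of_mem_interior {f : ℝ → ℝ} {S : Set ℝ} {s : ℝ}
    (hs : s ∈ interior S) :
    derivWithin (derivWithin f S) S s = deriv (deriv f) s := by
  rw [derivWithin_of_mem_nhds (mem_interior_iff_mem_nhds.1 hs)]
  refine Filter.EventuallyEq.deriv_eq ?_
  filter_upwards [isOpen_interior.mem_nhds hs] with t ht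
  exact derivWithin_of_mem_nhds (mem_interior_iff_mem_nhds.1 ht)

/-- A function continuous on `[0,1]` tends to `0` at `0⁺` after multiplication by `s`. -/
lemma tendsto_id_mul_nhdsGT_zero {g : ℝ → ℝ} (hg : ContinuousOn g (Icc 0 1)) :
    Tendsto (fun s => s * g s) (𝓝[>] 0) (𝓝 0) := by
  have hle : 𝓝[>] (0 : ℝ) ≤ 𝓝[Icc 0 1] 0 :=
    nhdsWithin_le_iff.2 (mem_of_superset (Ioo_mem_nhdsGT one_pos) Ioo_subset_Icc_self)
  have h0 : Tendsto (fun s : ℝ => s) (𝓝[>] 0) (𝓝 0) := nhdsWithin_le_nhds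
  simpa using h0.mul ((hg 0 (by simp)).mono_left hle)

/-- The derivative of `1 / (1 / (2 s) + g s) = 2 s / (1 + 2 s g s)`. -/
lemma hasDerivAt_two_mul_div_one_add {g : ℝ → ℝ} {g' s : ℝ} (hg : HasDerivAt g g' s)
    (hne : 1 + 2 * (s * g s) ≠ 0) :
    HasDerivAt (fun t => 2 * t / (1 + 2 * (t * g t)))
      ((2 - 4 * (s * (s * g'))) / (1 + 2 * (s * g s)) ^ 2) s := by
  have h1 : HasDerivAt (fun t : ℝ => 2 * t) (2 * 1) s := (hasDerivAt_id s).const_mul 2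
  have h2 : HasDerivAt (fun t => 1 + 2 * (t * g t)) (2 * (1 * g s + s * g')) s :=
    (((hasDerivAt_id s).mul hg).const_mul 2).const_add 1
  exact (h1.div h2 hne).congr_deriv (by ring)

/-- Let `f` be three times continuously differentiable on `[0,1]`, set
`V(s) = (1/2) s log s + f(s)` on `(0,1]` and assume
`V''(s) = 1/(2s) + f''(s) > 0` there.  Then `h = 1/V''` satisfies
`lim_{s→0⁺} h(s) = 0` and `lim_{s→0⁺} h'(s) = 2`. -/
theorem stmt6 (f : ℝ → ℝ) (hf : ContDiffOn ℝ 3 f (Icc 0 1))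
    (V : ℝ → ℝ) (hV : ∀ s ∈ Ioc (0:ℝ) 1, V s = 1 / 2 * s * Real.log s + f s)
    (hV'' : ∀ s ∈ Ioc (0:ℝ) 1,
      deriv (deriv V) s = 1 / (2 * s) + deriv (deriv f) s ∧ 0 < deriv (deriv V) s) :
    Tendsto (fun s => (deriv (deriv V) s)⁻¹) (𝓝[>] 0) (𝓝 0) ∧
    Tendsto (deriv fun s => (deriv (deriv V) s)⁻¹) (𝓝[>] 0) (𝓝 2) := by
  have hU : UniqueDiffOn ℝ (Icc (0 : ℝ) 1) := uniqueDiffOn_Icc one_pos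
  set g := derivWithin (derivWithin f (Icc 0 1)) (Icc 0 1) with hg_def
  have hg : ContDiffOn ℝ 1 g (Icc 0 1) :=
    (hf.derivWithin hU (m := 2) (by norm_num)).derivWithin hU (by norm_num)
  have hg' : ContinuousOn (derivWithin g (Icc 0 1)) (Icc 0 1) :=
    hg.continuousOn_derivWithin hU le_rfl
  have hformula : ∀ s ∈ Ioo (0 : ℝ) 1, 1 + 2 * (s * g s) ≠ 0 ∧
      (deriv (deriv V) s)⁻¹ = 2 * s / (1 + 2 * (s * g s)) := by
    intro s hs
    obtain ⟨heq, hpos⟩ := hV'' s (Ioo_subset_Ioc_self hs)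
    rw [← derivWithin_derivWithin_of_mem_interior (f := f) (S := Icc 0 1) (by rwa [interior_Icc]),
      ← hg_def] at heq
    have hs0 : s ≠ 0 := hs.1.ne'
    have hmul : 2 * s * deriv (deriv V) s = 1 + 2 * (s * g s) := by
      rw [heq]; field_simp
    rw [← hmul]
    refine ⟨by have := hs.1; positivity, ?_⟩
    have := hpos.ne'
    field_simp
  have hIoo : Ioo (0 : ℝ) 1 ∈ 𝓝[>] 0 := Ioo_mem_nhdsGT one_pos
  have h0 : Tendsto (fun s : ℝ => s) (𝓝[>] 0) (𝓝 0) := nhdsWithin_le_nhds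
  have hden : Tendsto (fun s => 1 + 2 * (s * g s)) (𝓝[>] 0) (𝓝 1) := by
    simpa using ((tendsto_id_mul_nhdsGT_zero hg.continuousOn).const_mul 2).const_add 1
  constructor
  · have hlim : Tendsto (fun s => 2 * s / (1 + 2 * (s * g s))) (𝓝[>] 0) (𝓝 0) := by
      simpa [Pi.div_def] using (h0.const_mul 2).div hden one_ne_zero
    refine hlim.congr' ?_
    filter_upwards [hIoo] with s hs using (hformula s hs).2.symm
  · have hlim : Tendsto (fun s => (2 - 4 * (s * (s * derivWithin g (Icc 0 1) s))) /
        (1 + 2 * (s * g s)) ^ 2) (𝓝[>] 0) (𝓝 2) := by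
      simpa [Pi.div_def] using (((h0.mul (tendsto_id_mul_nhdsGT_zero hg')).const_mul 4).const_sub 2).div
        (hden.pow 2) (by norm_num)
    refine hlim.congr' ?_
    filter_upwards [hIoo] with s hs
    have hgs : HasDerivAt g (derivWithin g (Icc 0 1) s) s :=
      ((hg.differentiableOn one_ne_zero s (Ioo_subset_Icc_self hs)).hasDerivWithinAt).hasDerivAt
        (Icc_mem_nhds hs.1 hs.2)
    refine ((hasDerivAt_two_mul_div_one_add hgs
      (hformula s hs).1).congr_of_eventuallyEq ?_).deriv.symm
    filter_upwards [isOpen_Ioo.mem_nhds hs] with t ht using (hformula t ht).2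
end

section
/- Assume (1/V'')''(t) ≤ C₁ for all t ∈ (0,ε], that g'(t) converges as t → 0⁺ to a limit L with |L| ≤ C₂, and that |g'(ε)| ≤ C₂. Then |g'(t)| ≤ C₂ + C₁·ε/8 for all t ∈ (0,ε]. -/
open Real Filter Set Topology

theorem monotoneOn_Ioc_of_hasDerivAt_nonneg {f f' : ℝ → ℝ} {a b : ℝ}
    (hf : ∀ t ∈ Ioc a b, HasDerivAt f (f' t) t) (hf' : ∀ t ∈ Ioc a b, 0 ≤ f' t) :
    MonotoneOn f (Ioc a b) :=
  monotoneOn_of_hasDerivWithinAt_nonneg (convex_Ioc a b)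
    (fun t ht => (hf t ht).continuousAt.continuousWithinAt)
    (fun t ht => (hf t (interior_subset ht)).hasDerivWithinAt)
    (fun t ht => hf' t (interior_subset ht))

theorem MonotoneOn.le_of_tendsto_nhdsGT {f : ℝ → ℝ} {a b l : ℝ}
    (hf : MonotoneOn f (Ioc a b)) (hl : Tendsto f (𝓝[>] a) (𝓝 l)) {t : ℝ}
    (ht : t ∈ Ioc a b) : l ≤ f t := by
  refine le_of_tendsto hl ?_
  filter_upwards [Ioc_mem_nhdsGT ht.1] with s hs
  exact hf ⟨hs.1, hs.2.trans ht.2⟩ ht hs.2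

/-- Integrating `h'' ≤ C` twice from the boundary values `h(0⁺) = 0`, `h'(0⁺) = 2`. -/
theorem le_two_mul_add_of_deriv_deriv_le {h : ℝ → ℝ} {C ε : ℝ}
    (hh : ∀ t ∈ Ioc (0:ℝ) ε, DifferentiableAt ℝ h t ∧ DifferentiableAt ℝ (deriv h) t)
    (hh0 : Tendsto h (𝓝[>] 0) (𝓝 0)) (hh1 : Tendsto (deriv h) (𝓝[>] 0) (𝓝 2))
    (hC : ∀ t ∈ Ioc (0:ℝ) ε, deriv (deriv h) t ≤ C) {t : ℝ} (ht : t ∈ Ioc (0:ℝ) ε) :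
    h t ≤ 2 * t + C * t ^ 2 / 2 := by
  have hd1 : ∀ t ∈ Ioc (0:ℝ) ε,
      HasDerivAt (fun s => 2 + C * s - deriv h s) (C - deriv (deriv h) t) t := fun t ht => by
    have h1 := (((hasDerivAt_id' t).const_mul C).const_add 2).sub (hh t ht).2.hasDerivAt
    rwa [mul_one] at h1
  have hd0 : ∀ t ∈ Ioc (0:ℝ) ε,
      HasDerivAt (fun s => 2 * s + C * s ^ 2 / 2 - h s) (2 + C * t - deriv h t) t :=
    fun t ht => by
      have h1 := (((hasDerivAt_id' t).const_mul 2).add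
        (((hasDerivAt_pow 2 t).const_mul C).div_const 2)).sub (hh t ht).1.hasDerivAt
      refine h1.congr_deriv ?_
      norm_num
      ring
  have hl1 : Tendsto (fun s => 2 + C * s - deriv h s) (𝓝[>] 0) (𝓝 0) := by
    have h1 : Tendsto (fun s : ℝ => 2 + C * s) (𝓝[>] 0) (𝓝 (2 + C * 0)) :=
      ((by fun_prop : Continuous fun s : ℝ => 2 + C * s).tendsto 0).mono_left nhdsWithin_le_nhds
    simpa using h1.sub hh1
  have hl0 : Tendsto (fun s => 2 * s + C * s ^ 2 / 2 - h s) (𝓝[>] 0) (𝓝 0) := by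
    have h1 : Tendsto (fun s : ℝ => 2 * s + C * s ^ 2 / 2) (𝓝[>] 0)
        (𝓝 (2 * 0 + C * 0 ^ 2 / 2)) :=
      ((by fun_prop : Continuous fun s : ℝ => 2 * s + C * s ^ 2 / 2).tendsto 0).mono_left
        nhdsWithin_le_nhds
    simpa using h1.sub hh0
  have hm1 := monotoneOn_Ioc_of_hasDerivAt_nonneg hd1 fun t ht => sub_nonneg.2 (hC t ht)
  have hm0 := monotoneOn_Ioc_of_hasDerivAt_nonneg hd0 fun t ht => hm1.le_of_tendsto_nhdsGT hl1 ht
  exact sub_nonneg.1 (hm0.le_of_tendsto_nhdsGT hl0 ht)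

theorem neg_div_eight_le_of_inv_le {C t v : ℝ} (hC : 0 ≤ C) (ht : 0 < t) (hv : 0 < v)
    (h : v⁻¹ ≤ 2 * t + C * t ^ 2 / 2) : -(C / 8) ≤ v - 1 / (2 * t) := by
  have h1 : (2 * t + C * t ^ 2 / 2)⁻¹ ≤ v := inv_le_of_inv_le₀ hv h
  have h2 : (2 * t + C * t ^ 2 / 2)⁻¹ - 1 / (2 * t) + C / 8 = C ^ 2 * t / (8 * (4 + C * t)) := by
    have : 4 + C * t ≠ 0 := by positivity
    have h3 : 2 * t + C * t ^ 2 / 2 = t * (4 + C * t) / 2 := by ring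
    rw [h3]
    field_simp
    ring
  have h4 : 0 ≤ C ^ 2 * t / (8 * (4 + C * t)) := by positivity
  linarith

/-- Let `C₁, C₂ > 0`, `ε ∈ (0,1]`, `g` twice differentiable on `(0,ε]`, and
`V(t) = (1/2) t log t + g(t)` with `V''(t) = 1/(2t) + g''(t) > 0` on `(0,ε]`.
Assume `h = 1/V''` is twice differentiable with `h(t) → 0`, `h'(t) → 2` as
`t → 0⁺`, that `(1/V'')''(t) ≤ C₁` on `(0,ε]`, that `g'(t)` converges as
`t → 0⁺` to a limit `L` with `|L| ≤ C₂`, and that `|g'(ε)| ≤ C₂`.  Then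
`|g'(t)| ≤ C₂ + C₁ ε / 8` for all `t ∈ (0,ε]`. -/
theorem stmt8 (C₁ C₂ ε : ℝ) (hC₁ : 0 < C₁) (hC₂ : 0 < C₂) (hε : ε ∈ Ioc (0:ℝ) 1)
    (g : ℝ → ℝ)
    (hg : ∀ t ∈ Ioc (0:ℝ) ε, DifferentiableAt ℝ g t ∧ DifferentiableAt ℝ (deriv g) t)
    (V : ℝ → ℝ) (hV : ∀ t ∈ Ioc (0:ℝ) ε, V t = 1 / 2 * t * Real.log t + g t)
    (hV'' : ∀ t ∈ Ioc (0:ℝ) ε,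
      deriv (deriv V) t = 1 / (2 * t) + deriv (deriv g) t ∧ 0 < deriv (deriv V) t)
    (hh : ∀ t ∈ Ioc (0:ℝ) ε,
      DifferentiableAt ℝ (fun s => (deriv (deriv V) s)⁻¹) t ∧
      DifferentiableAt ℝ (deriv fun s => (deriv (deriv V) s)⁻¹) t)
    (hh0 : Tendsto (fun s => (deriv (deriv V) s)⁻¹) (𝓝[>] 0) (𝓝 0))
    (hh1 : Tendsto (deriv fun s => (deriv (deriv V) s)⁻¹) (𝓝[>] 0) (𝓝 2))
    (hcurv : ∀ t ∈ Ioc (0:ℝ) ε,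
      deriv (deriv fun s => (deriv (deriv V) s)⁻¹) t ≤ C₁)
    (L : ℝ) (hgL : Tendsto (deriv g) (𝓝[>] 0) (𝓝 L)) (hL : |L| ≤ C₂)
    (hgε : |deriv g ε| ≤ C₂) :
    ∀ t ∈ Ioc (0:ℝ) ε, |deriv g t| ≤ C₂ + C₁ * ε / 8 := by
  have hd : ∀ t ∈ Ioc (0:ℝ) ε,
      HasDerivAt (fun s => deriv g s + C₁ / 8 * s) (deriv (deriv g) t + C₁ / 8) t :=
    fun t ht => by
      have h1 := (hg t ht).2.hasDerivAt.add ((hasDerivAt_id' t).const_mul (C₁ / 8))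
      rwa [mul_one] at h1
  have hm : MonotoneOn (fun s => deriv g s + C₁ / 8 * s) (Ioc 0 ε) := by
    refine monotoneOn_Ioc_of_hasDerivAt_nonneg hd fun t ht => ?_
    have h1 := neg_div_eight_le_of_inv_le hC₁.le ht.1 (hV'' t ht).2
      (le_two_mul_add_of_deriv_deriv_le hh hh0 hh1 hcurv ht)
    linarith [(hV'' t ht).1]
  have hl : Tendsto (fun s => deriv g s + C₁ / 8 * s) (𝓝[>] 0) (𝓝 L) := by
    have h1 : Tendsto (fun s : ℝ => C₁ / 8 * s) (𝓝[>] 0) (𝓝 (C₁ / 8 * 0)) :=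
      ((by fun_prop : Continuous fun s : ℝ => C₁ / 8 * s).tendsto 0).mono_left nhdsWithin_le_nhds
    simpa using hgL.add h1
  intro t ht
  have hlow : L ≤ deriv g t + C₁ / 8 * t := hm.le_of_tendsto_nhdsGT hl ht
  have hupp : deriv g t + C₁ / 8 * t ≤ deriv g ε + C₁ / 8 * ε := hm ht ⟨hε.1, le_rfl⟩ ht.2
  have h1 : C₁ / 8 * t ≤ C₁ / 8 * ε := by gcongr; exact ht.2
  have h2 : 0 ≤ C₁ / 8 * t := mul_nonneg (by positivity) ht.1.le
  rw [abs_le] at hL hgε ⊢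
  constructor <;> linarith [hL.1, hgε.2]
end

section
/- Let C ≥ 0 and let g : (0,1] → ℝ be twice differentiable with |g'(t)| ≤ C for all t ∈ (0,1]. Set V(t) = (1/2)·t·log t + g(t) and assume V''(t) ≥ 0 for all t ∈ (0,1]. Then the Lebesgue integral ∫₀¹ √(V''(t)) dt is at most (√2 + 1)·√((log 2)/2 + 2C). -/
open Real Filter Set Topology MeasureTheory

/-- Cauchy–Schwarz for the square root of a nonnegative derivative on an interval, in terms of an
upper bound `K` for the increment of the primitive. -/
lemma lintegral_sqrt_deriv_le {F f : ℝ → ℝ} {a b K : ℝ} (hab : a < b) (hK : 0 < K)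
    (hcont : ContinuousOn F (Icc a b)) (hderiv : ∀ t ∈ Ioo a b, HasDerivAt F (f t) t)
    (hf : ∀ t ∈ Ioo a b, 0 ≤ f t) (hF : F b - F a ≤ K) :
    ∫⁻ t in Ioc a b, ENNReal.ofReal √(f t) ≤ ENNReal.ofReal √((b - a) * K) := by
  have hint : IntegrableOn f (Ioc a b) :=
    intervalIntegral.integrableOn_deriv_of_nonneg hcont hderiv hf
  have hint' : IntegrableOn f (Ioo a b) := hint.mono_set Ioo_subset_Ioc_self
  have hftc : ∫ t in Ioo a b, f t = F b - F a := by
    rw [← integral_Ioc_eq_integral_Ioo, ← intervalIntegral.integral_of_le hab.le]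
    exact intervalIntegral.integral_eq_sub_of_hasDerivAt_of_le hab.le hcont hderiv
      ((intervalIntegrable_iff_integrableOn_Ioc_of_le hab.le).2 hint)
  have hba : 0 < b - a := sub_pos.2 hab
  obtain ⟨p, hp, hp2⟩ : ∃ p : ℝ, 0 < p ∧ p ^ 2 = b - a :=
    ⟨√(b - a), sqrt_pos.2 hba, sq_sqrt hba.le⟩
  obtain ⟨q, hq, hq2⟩ : ∃ q : ℝ, 0 < q ∧ q ^ 2 = K := ⟨√K, sqrt_pos.2 hK, sq_sqrt hK.le⟩
  have hpt : ∀ t ∈ Ioo a b, √(f t) ≤ p / (2 * q) * f t + q / (2 * p) := by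
    intro t ht
    have hsq := sq_sqrt (hf t ht)
    have key : p / (2 * q) * f t + q / (2 * p) - √(f t)
        = (p * √(f t) - q) ^ 2 / (2 * p * q) := by
      nth_rewrite 1 [← hsq]
      field_simp
      ring
    have : 0 ≤ (p * √(f t) - q) ^ 2 / (2 * p * q) := by positivity
    linarith
  have hint2 : IntegrableOn (fun t => p / (2 * q) * f t + q / (2 * p)) (Ioo a b) :=
    (hint'.const_mul _).add (integrableOn_const (by simp))
  calc ∫⁻ t in Ioc a b, ENNReal.ofReal √(f t)
      = ∫⁻ t in Ioo a b, ENNReal.ofReal √(f t) := by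
        rw [Measure.restrict_congr_set Ioo_ae_eq_Ioc]
    _ ≤ ∫⁻ t in Ioo a b, ENNReal.ofReal (p / (2 * q) * f t + q / (2 * p)) :=
        setLIntegral_mono' measurableSet_Ioo fun t ht => ENNReal.ofReal_le_ofReal (hpt t ht)
    _ = ENNReal.ofReal (∫ t in Ioo a b, (p / (2 * q) * f t + q / (2 * p))) := by
        refine (ofReal_integral_eq_lintegral_ofReal hint2 ?_).symm
        exact (ae_restrict_mem measurableSet_Ioo).mono fun t ht =>
          (sqrt_nonneg _).trans (hpt t ht)
    _ ≤ ENNReal.ofReal √((b - a) * K) := by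
        apply ENNReal.ofReal_le_ofReal
        rw [integral_add (hint'.const_mul _) (integrableOn_const (by simp)),
          integral_const_mul, hftc, setIntegral_const, Real.volume_real_Ioo_of_le hab.le, ← hp2,
          ← hq2, ← mul_pow, sqrt_sq (by positivity), smul_eq_mul]
        calc p / (2 * q) * (F b - F a) + p ^ 2 * (q / (2 * p))
            ≤ p / (2 * q) * q ^ 2 + p ^ 2 * (q / (2 * p)) := by
              rw [← hq2] at hF
              gcongr
          _ = p * q := by
              field_simp
              ring

lemma Ioc_zero_one_subset_iUnion_dyadic :
    Ioc (0:ℝ) 1 ⊆ ⋃ i : ℕ, Ioc ((1 / 2 : ℝ) ^ (i + 1)) ((1 / 2) ^ i) := by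
  rintro t ⟨h0, h1⟩
  obtain ⟨n, hn⟩ := exists_nat_pow_near_of_lt_one h0 h1 (by norm_num : (0:ℝ) < 1 / 2) (by norm_num)
  exact mem_iUnion.2 ⟨n, hn⟩

lemma hasSum_sqrt_half_pow_mul (K : ℝ) :
    HasSum (fun i : ℕ => √((1 / 2 : ℝ) ^ (i + 1) * K)) ((√2 + 1) * √K) := by
  have h2 : √2 ^ 2 = 2 := sq_sqrt (by norm_num)
  have h1 : 1 < √2 := by
    rw [lt_sqrt (by norm_num)]
    norm_num
  have hr : (√2)⁻¹ < 1 := inv_lt_one_of_one_lt₀ h1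
  have h := (hasSum_geometric_of_lt_one (by positivity) hr).mul_right ((√2)⁻¹ * √K)
  have hterm : ∀ i : ℕ, √((1 / 2 : ℝ) ^ (i + 1) * K) = (√2)⁻¹ ^ i * ((√2)⁻¹ * √K) := by
    intro i
    have : (1 / 2 : ℝ) ^ (i + 1) = ((√2)⁻¹ ^ (i + 1)) ^ 2 := by
      rw [← pow_mul, mul_comm, pow_mul, inv_pow, h2, one_div]
    rw [sqrt_mul (by positivity), this, sqrt_sq (by positivity)]
    ring
  have hval : (√2 + 1) * √K = (1 - (√2)⁻¹)⁻¹ * ((√2)⁻¹ * √K) := by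
    have h3 : √2 - 1 ≠ 0 := (sub_pos.2 h1).ne'
    field_simp
    linear_combination √K * h2
  simpa only [hterm, hval] using h

/-- Let `C ≥ 0` and let `g` be twice differentiable on `(0,1]` with
`|g'(t)| ≤ C` there.  Set `V(t) = (1/2) t log t + g(t)` and assume
`V''(t) ≥ 0` on `(0,1]`.  Then the Lebesgue integral `∫₀¹ √(V''(t)) dt` is at
most `(√2 + 1) √((log 2)/2 + 2C)`.  (This is the length of a segment from a
vertex of the moment polygon in the toric Kähler metric, bounding the
diameter of the toric surface.) -/
theorem stmt10 (C : ℝ) (hC : 0 ≤ C) (g : ℝ → ℝ)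
    (hg : ∀ t ∈ Ioc (0:ℝ) 1, DifferentiableAt ℝ g t ∧ DifferentiableAt ℝ (deriv g) t)
    (hg' : ∀ t ∈ Ioc (0:ℝ) 1, |deriv g t| ≤ C)
    (V : ℝ → ℝ) (hV : ∀ t ∈ Ioc (0:ℝ) 1, V t = 1 / 2 * t * Real.log t + g t)
    (hV'' : ∀ t ∈ Ioc (0:ℝ) 1, 0 ≤ deriv (deriv V) t) :
    ∫⁻ t in Ioc (0:ℝ) 1, ENNReal.ofReal (Real.sqrt (deriv (deriv V) t)) ≤
      ENNReal.ofReal ((Real.sqrt 2 + 1) * Real.sqrt (Real.log 2 / 2 + 2 * C)) := by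
  have hK : 0 < Real.log 2 / 2 + 2 * C := by
    have := Real.log_pos one_lt_two
    positivity
  have hVd : ∀ t ∈ Ioo (0:ℝ) 1, deriv V t = 1 / 2 * Real.log t + deriv g t + 1 / 2 := by
    intro t ht
    have hev : V =ᶠ[𝓝 t] fun t => 1 / 2 * (t * Real.log t) + g t := by
      filter_upwards [isOpen_Ioo.mem_nhds ht] with s hs
      rw [hV s (Ioo_subset_Ioc_self hs), mul_assoc]
    have hd := ((Real.hasDerivAt_mul_log ht.1.ne').const_mul (1 / 2)).add
      (hg t (Ioo_subset_Ioc_self ht)).1.hasDerivAt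
    rw [(hd.congr_of_eventuallyEq hev).deriv]
    ring
  have hFd : ∀ t ∈ Ioc (0:ℝ) 1,
      DifferentiableAt ℝ (fun t => 1 / 2 * Real.log t + deriv g t + 1 / 2) t := fun t ht =>
    (((Real.differentiableAt_log ht.1.ne').const_mul _).add (hg t ht).2).add_const _
  have hVdd : ∀ t ∈ Ioo (0:ℝ) 1,
      HasDerivAt (fun t => 1 / 2 * Real.log t + deriv g t + 1 / 2) (deriv (deriv V) t) t := by
    intro t ht
    have hev := Filter.eventuallyEq_of_mem (isOpen_Ioo.mem_nhds ht) hVd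
    rw [hev.deriv_eq]
    exact (hFd t (Ioo_subset_Ioc_self ht)).hasDerivAt
  have hpiece : ∀ i : ℕ, ∫⁻ t in Ioc ((1 / 2 : ℝ) ^ (i + 1)) ((1 / 2) ^ i),
      ENNReal.ofReal √(deriv (deriv V) t) ≤
        ENNReal.ofReal √((1 / 2 : ℝ) ^ (i + 1) * (Real.log 2 / 2 + 2 * C)) := by
    intro i
    have hpos : (0:ℝ) < (1 / 2) ^ (i + 1) := by positivity
    have hle : (1 / 2 : ℝ) ^ i ≤ 1 := pow_le_one₀ (by norm_num) (by norm_num)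
    have hdouble : (1 / 2 : ℝ) ^ i = 2 * (1 / 2) ^ (i + 1) := by ring
    rw [hdouble] at hle ⊢
    generalize (1 / 2 : ℝ) ^ (i + 1) = a at hpos hle
    have hIoo : Ioo a (2 * a) ⊆ Ioo 0 1 := Ioo_subset_Ioo hpos.le hle
    have hbound := lintegral_sqrt_deriv_le (by linarith : a < 2 * a) hK
      (fun t ht => (hFd t ⟨hpos.trans_le ht.1, ht.2.trans hle⟩).continuousAt.continuousWithinAt)
      (fun t ht => hVdd t (hIoo ht)) (fun t ht => hV'' t (Ioo_subset_Ioc_self (hIoo ht))) (by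
        have h1 := abs_le.1 (hg' a ⟨hpos, by linarith⟩)
        have h2 := abs_le.1 (hg' (2 * a) ⟨by linarith, hle⟩)
        rw [Real.log_mul two_ne_zero hpos.ne']
        linarith [h1.1, h2.2])
    rwa [show 2 * a - a = a by ring] at hbound
  have hsum := hasSum_sqrt_half_pow_mul (Real.log 2 / 2 + 2 * C)
  calc _ ≤ ∫⁻ t in ⋃ i : ℕ, Ioc ((1 / 2 : ℝ) ^ (i + 1)) ((1 / 2) ^ i),
        ENNReal.ofReal √(deriv (deriv V) t) := lintegral_mono_set Ioc_zero_one_subset_iUnion_dyadic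
    _ ≤ ∑' i : ℕ, ∫⁻ t in Ioc ((1 / 2 : ℝ) ^ (i + 1)) ((1 / 2) ^ i),
        ENNReal.ofReal √(deriv (deriv V) t) := lintegral_iUnion_le _ _
    _ ≤ ∑' i : ℕ, ENNReal.ofReal √((1 / 2 : ℝ) ^ (i + 1) * (Real.log 2 / 2 + 2 * C)) :=
        ENNReal.tsum_le_tsum hpiece
    _ = _ := by
        rw [← ENNReal.ofReal_tsum_of_nonneg (fun _ => sqrt_nonneg _) hsum.summable, hsum.tsum_eq]
end

section
/- Let n ≥ 1, C ≥ 0, and for i = 1,…,n let ℓᵢ(t) = pᵢ + qᵢ·t be affine functions of t ∈ ℝ that are positive on the open interval (0,1). Let g : (0,1) → ℝ be differentiable with |g'(t)| ≤ C for all t ∈ (0,1). Define φ(t) = (1/2)·Σ_{i=1}^n ℓᵢ(t)·log ℓᵢ(t) + g(t) for t ∈ (0,1). Then |φ'(2/3) − φ'(1/3)| ≤ 2C + ((log 2)/2)·Σ_{i=1}^n |qᵢ|. -/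
open Real Filter Set Topology

/-- An affine function positive on `(0,1)` is nonnegative at both endpoints. -/
theorem affine_endpoints_nonneg {p q : ℝ} (h : ∀ t ∈ Ioo (0:ℝ) 1, 0 < p + q * t) :
    0 ≤ p ∧ 0 ≤ p + q := by
  have hcont : Continuous fun t : ℝ => p + q * t := by fun_prop
  have hclosure : ∀ t ∈ closure (Ioo (0:ℝ) 1), 0 ≤ p + q * t := fun t ht =>
    closure_minimal (fun s hs => (h s hs).le) (isClosed_Ici.preimage hcont) ht
  rw [closure_Ioo zero_ne_one] at hclosure
  exact ⟨by simpa using hclosure 0 (by simp), by simpa using hclosure 1 (by simp)⟩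

theorem abs_log_sub_log_le_log_two {a b : ℝ} (ha : 0 < a) (hb : 0 < b)
    (hab : a ≤ 2 * b) (hba : b ≤ 2 * a) : |Real.log a - Real.log b| ≤ Real.log 2 := by
  have h₁ := Real.log_le_log ha hab
  have h₂ := Real.log_le_log hb hba
  rw [Real.log_mul two_ne_zero hb.ne'] at h₁
  rw [Real.log_mul two_ne_zero ha.ne'] at h₂
  exact abs_sub_le_iff.mpr ⟨by linarith, by linarith⟩

theorem hasDerivAt_affine_mul_log {p q t : ℝ} (h : 0 < p + q * t) :
    HasDerivAt (fun s => (p + q * s) * Real.log (p + q * s))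
      (q * (Real.log (p + q * t) + 1)) t := by
  have haff : HasDerivAt (fun s => p + q * s) q t := by
    simpa using ((hasDerivAt_id t).const_mul q).const_add p
  simpa only [Function.comp_def, mul_comm q] using (Real.hasDerivAt_mul_log h.ne').comp t haff

/-- Let `n ≥ 1`, `C ≥ 0`, and for `i = 1,…,n` let `ℓᵢ(t) = pᵢ + qᵢ t` be affine
functions positive on `(0,1)`.  Let `g` be differentiable on `(0,1)` with
`|g'(t)| ≤ C`, and define `φ(t) = (1/2) Σᵢ ℓᵢ(t) log ℓᵢ(t) + g(t)`.  Then
`|φ'(2/3) − φ'(1/3)| ≤ 2C + ((log 2)/2) Σᵢ |qᵢ|`.  (This yields Donaldson's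
`M`-condition for the symplectic potential along the segment.) -/
theorem stmt13 (n : ℕ) (hn : 1 ≤ n) (C : ℝ) (hC : 0 ≤ C)
    (p q : Fin n → ℝ)
    (hpos : ∀ i : Fin n, ∀ t ∈ Ioo (0:ℝ) 1, 0 < p i + q i * t)
    (g : ℝ → ℝ)
    (hg : ∀ t ∈ Ioo (0:ℝ) 1, DifferentiableAt ℝ g t ∧ |deriv g t| ≤ C)
    (φ : ℝ → ℝ)
    (hφ : ∀ t ∈ Ioo (0:ℝ) 1,
      φ t = 1 / 2 * ∑ i : Fin n, (p i + q i * t) * Real.log (p i + q i * t) + g t) :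
    |deriv φ (2/3) - deriv φ (1/3)| ≤ 2 * C + Real.log 2 / 2 * ∑ i : Fin n, |q i| := by
  have hderiv : ∀ t ∈ Ioo (0:ℝ) 1, deriv φ t =
      1 / 2 * ∑ i : Fin n, q i * (Real.log (p i + q i * t) + 1) + deriv g t := by
    intro t ht
    have hsum := HasDerivAt.fun_sum (u := Finset.univ)
      fun i _ => hasDerivAt_affine_mul_log (hpos i t ht)
    refine (((hsum.const_mul (1 / 2)).add (hg t ht).1.hasDerivAt).congr_of_eventuallyEq ?_).deriv
    filter_upwards [isOpen_Ioo.mem_nhds ht] with s hs using hφ s hs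
  have h₁ : (1 / 3 : ℝ) ∈ Ioo (0:ℝ) 1 := by norm_num
  have h₂ : (2 / 3 : ℝ) ∈ Ioo (0:ℝ) 1 := by norm_num
  have hlog : |∑ i : Fin n, q i *
      (Real.log (p i + q i * (2 / 3)) - Real.log (p i + q i * (1 / 3)))| ≤
      Real.log 2 * ∑ i : Fin n, |q i| := by
    rw [Finset.mul_sum]
    refine (Finset.abs_sum_le_sum_abs _ _).trans (Finset.sum_le_sum fun i _ => ?_)
    obtain ⟨h0, h1⟩ := affine_endpoints_nonneg (hpos i)
    rw [abs_mul, mul_comm]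
    exact mul_le_mul_of_nonneg_right (abs_log_sub_log_le_log_two (hpos i _ h₂) (hpos i _ h₁)
      (by linarith) (by linarith)) (abs_nonneg _)
  have hsub : deriv φ (2 / 3) - deriv φ (1 / 3) = 1 / 2 * ∑ i : Fin n, q i *
      (Real.log (p i + q i * (2 / 3)) - Real.log (p i + q i * (1 / 3))) +
      (deriv g (2 / 3) - deriv g (1 / 3)) := by
    rw [hderiv _ h₁, hderiv _ h₂]
    simp only [mul_add, mul_sub, Finset.sum_add_distrib, Finset.sum_sub_distrib]
    ring
  have hg₁ := abs_le.mp (hg _ h₁).2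
  have hg₂ := abs_le.mp (hg _ h₂).2
  rw [abs_le] at hlog
  rw [hsub, abs_le]
  constructor <;> linarith [hlog.1, hlog.2, hg₁.1, hg₁.2, hg₂.1, hg₂.2]
end
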